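/- (Fully discrete, lower bound.) Assume (δ_N)_N and (ε_N)_N converge to 0 and μ⁰_N converges narrowly to μ⁰ in P(ℝ^d). If (Q_N)_N converges narrowly to Q_∞ in P(Γ), then J(Q_∞) ≤ liminf_{N→∞} J_{δ_N, ε_N}(Q_N). -/

import Mathlib

open MeasureTheory Filter Topology Set
open scoped ENNReal NNReal

noncomputable section

abbrev Euc (d : ℕ) : Type := EuclideanSpace ℝ (Fin d)

abbrev Traj (d : ℕ) (T : ℝ) : Type := C(Set.Icc (0:ℝ) T, Euc d)

instance (d : ℕ) (T : ℝ) : MeasurableSpace (Traj d T) := borel _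
instance (d : ℕ) (T : ℝ) : BorelSpace (Traj d T) := ⟨rfl⟩

/-- evaluation of a trajectory at time `t ∈ ℝ` (projected onto `[0,T]`). -/
def evalAt {d : ℕ} {T : ℝ} (hT : 0 ≤ T) (t : ℝ) (γ : Traj d T) : Euc d :=
  γ (Set.projIcc 0 T hT t)

/-- Narrow convergence of a sequence of measures. -/
def NarrowTendsto {X : Type*} [TopologicalSpace X] [MeasurableSpace X]
    (μ : ℕ → Measure X) (ν : Measure X) : Prop :=
  ∀ f : BoundedContinuousFunction X ℝ,
    Tendsto (fun n => ∫ x, f x ∂(μ n)) atTop (𝓝 (∫ x, f x ∂ν))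

/-- Squared 2-Wasserstein distance. -/
def W2sq {X : Type*} [MeasurableSpace X] [PseudoMetricSpace X]
    (μ ν : Measure X) : ℝ≥0∞ :=
  ⨅ (π : Measure (X × X)) (_ : π.map Prod.fst = μ ∧ π.map Prod.snd = ν),
    ∫⁻ p, ENNReal.ofReal (dist p.1 p.2 ^ 2) ∂π

/-- Uniform discrete probability measures on `N` points. -/
def IsUnifDiscrete {X : Type*} [MeasurableSpace X] (N : ℕ) (μ : Measure X) : Prop :=
  ∃ x : Fin N → X, μ = ((N : ℝ≥0∞))⁻¹ • ∑ i, MeasureTheory.Measure.dirac (x i)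

/-- Shifted (by `+C`) kinetic action: equals `∫₀ᵀ (L(γ'(t)) + C) dt` if `γ ∈ W^{1,r}`,
`+∞` otherwise. -/
def actionN {d : ℕ} {T : ℝ} (L : Euc d → ℝ) (C : ℝ) (γ : Traj d T) : ℝ≥0∞ :=
  sInf { a : ℝ≥0∞ | ∃ g : ℝ → Euc d, IntervalIntegrable g volume 0 T ∧
      (∀ s t : Set.Icc (0:ℝ) T, γ t - γ s = ∫ u in (s:ℝ)..(t:ℝ), g u) ∧
      a = ∫⁻ t in Set.Ioc (0:ℝ) T, ENNReal.ofReal (L (g t) + C) }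

/-- Kinetic part of the energy: `∫_Γ L(γ) dQ(γ)`. -/
def kinE {d : ℕ} {T : ℝ} (L : Euc d → ℝ) (C : ℝ) (Q : Measure (Traj d T)) : EReal :=
  ((∫⁻ γ, actionN L C γ ∂Q : ℝ≥0∞) : EReal) - ((C * T : ℝ) : EReal)

/-- The mean-field game energy `J`. -/
def Jfun {d : ℕ} {T : ℝ} (hT : 0 ≤ T) (L : Euc d → ℝ) (C : ℝ)
    (F : Measure (Euc d) → ℝ≥0∞) (G : Measure (Traj d T) → ℝ)
    (Q : Measure (Traj d T)) : EReal :=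
  kinE L C Q
    + ((∫⁻ t in Set.Ioc (0:ℝ) T, F (Q.map (evalAt hT t)) : ℝ≥0∞) : EReal)
    + ((G Q : ℝ) : EReal)

/-- Moreau envelope of `F` with parameter `ε` in the 2-Wasserstein space. -/
def moreau {d : ℕ} (Ω : Set (Euc d)) (F : Measure (Euc d) → ℝ≥0∞) (ε : ℝ)
    (μ : Measure (Euc d)) : ℝ≥0∞ :=
  ⨅ (ρ : Measure (Euc d)) (_ : IsProbabilityMeasure ρ ∧ ρ Ωᶜ = 0),
    W2sq μ ρ / ENNReal.ofReal (2 * ε) + F ρ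

/-- The regularized energy `J_ε`. -/
def Jeps {d : ℕ} {T : ℝ} (hT : 0 ≤ T) (Ω : Set (Euc d)) (L : Euc d → ℝ) (C : ℝ)
    (F : Measure (Euc d) → ℝ≥0∞) (G : Measure (Traj d T) → ℝ) (ε : ℝ)
    (Q : Measure (Traj d T)) : EReal :=
  kinE L C Q
    + ((∫⁻ t in Set.Ioc (0:ℝ) T, moreau Ω F ε (Q.map (evalAt hT t)) : ℝ≥0∞) : EReal)
    + ((G Q : ℝ) : EReal)

end

noncomputable section

/-- The fully time-discretized energy `J_{δ,ε}`, for the uniform grid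
`0, δ, …, Mδ = T`. -/
def Jde {d : ℕ} {T : ℝ} (hT : 0 ≤ T) (Ω : Set (Euc d)) (L : Euc d → ℝ) (C : ℝ)
    (F : Measure (Euc d) → ℝ≥0∞) (G : Measure (Traj d T) → ℝ) (δ ε : ℝ) (M : ℕ)
    (Q : Measure (Traj d T)) : EReal :=
  kinE L C Q
    + ((ENNReal.ofReal δ *
        ∑ i ∈ Finset.Ico 1 M, moreau Ω F ε (Q.map (evalAt hT (i * δ))) : ℝ≥0∞) : EReal)
    + ((G Q : ℝ) : EReal)

/-- A trajectory which is affine on each interval `[iδ, (i+1)δ]`, `i = 0, …, M−1`. -/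
def PiecewiseAffine {d : ℕ} {T : ℝ} (hT : 0 ≤ T) (δ : ℝ) (M : ℕ) (γ : Traj d T) : Prop :=
  ∀ i : ℕ, i < M → ∀ a ∈ Set.Icc (0:ℝ) 1,
    evalAt hT ((1 - a) * (i * δ) + a * ((i + 1) * δ)) γ
      = (1 - a) • evalAt hT (i * δ) γ + a • evalAt hT ((i + 1) * δ) γ

/-- Uniform discrete measures on `N` piecewise-affine trajectories: `P_N(Γ^lin_δ)`. -/
def IsUnifDiscreteAffine {d : ℕ} {T : ℝ} (hT : 0 ≤ T) (N : ℕ) (δ : ℝ) (M : ℕ)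
    (Q : Measure (Traj d T)) : Prop :=
  ∃ x : Fin N → Traj d T, (∀ i, PiecewiseAffine hT δ M (x i)) ∧
    Q = ((N : ℝ≥0∞))⁻¹ • ∑ i, MeasureTheory.Measure.dirac (x i)

end


section Helpers

/-- Bundle a probability measure. -/
def mkPM {X : Type*} [MeasurableSpace X] (μ : Measure X) (h : IsProbabilityMeasure μ) :
    ProbabilityMeasure X := ⟨μ, h⟩

lemma coe_mkPM {X : Type*} [MeasurableSpace X] (μ : Measure X) (h : IsProbabilityMeasure μ) :
    (mkPM μ h : Measure X) = μ := rfl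

lemma narrow_to_prob {X : Type*} [TopologicalSpace X] [MeasurableSpace X] [OpensMeasurableSpace X]
    {μ : ℕ → Measure X} {ν : Measure X} (hμ : ∀ n, IsProbabilityMeasure (μ n))
    (hν : IsProbabilityMeasure ν) :
    NarrowTendsto μ ν ↔
      Tendsto (β := ProbabilityMeasure X) (fun n => mkPM (μ n) (hμ n)) atTop
        (𝓝 (mkPM ν hν)) := by
  rw [ProbabilityMeasure.tendsto_iff_forall_integral_tendsto]
  rfl

lemma measurable_evalAt {d : ℕ} {T : ℝ} (hT : 0 ≤ T) (t : ℝ) :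
    Continuous (evalAt (d := d) hT t) := by
  unfold evalAt
  fun_prop

lemma narrow_evalAt {d : ℕ} {T : ℝ} (hT : 0 ≤ T) {Q : ℕ → Measure (Traj d T)}
    {Qlim : Measure (Traj d T)} (hQ : ∀ n, IsProbabilityMeasure (Q n))
    (hQlim : IsProbabilityMeasure Qlim) (h : NarrowTendsto Q Qlim)
    {s : ℕ → ℝ} {t : ℝ} (hs : Tendsto s atTop (𝓝 t)) :
    NarrowTendsto (fun n => (Q n).map (evalAt hT (s n))) (Qlim.map (evalAt hT t)) := by
  rw [narrow_to_prob hQ hQlim] at h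
  have h2 : Tendsto (fun n => diracProba (Set.projIcc 0 T hT (s n))) atTop
      (𝓝 (diracProba (Set.projIcc 0 T hT t))) :=
    (continuous_diracProba.tendsto _).comp ((continuous_projIcc.tendsto _).comp hs)
  have h3 := (ProbabilityMeasure.continuous_prod.tendsto _).comp (h.prodMk_nhds h2)
  have hev : Continuous (fun p : Traj d T × Set.Icc (0:ℝ) T => p.1 p.2) := by fun_prop
  have h4 := ProbabilityMeasure.tendsto_map_of_tendsto_of_continuous _ _ h3 hev
  have key : ∀ (P : Measure (Traj d T)) (hP : IsProbabilityMeasure P) (u : ℝ),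
      (((ProbabilityMeasure.prod (mkPM P hP) (diracProba (Set.projIcc 0 T hT u))).map
        hev.aemeasurable : ProbabilityMeasure (Euc d)) : Measure (Euc d)) =
        P.map (evalAt hT u) := by
    intro P hP u
    have hd : ((diracProba (Set.projIcc 0 T hT u) : ProbabilityMeasure (Set.Icc (0:ℝ) T)) :
      Measure (Set.Icc (0:ℝ) T)) = Measure.dirac (Set.projIcc 0 T hT u) := rfl
    rw [ProbabilityMeasure.toMeasure_map, ProbabilityMeasure.toMeasure_prod, coe_mkPM, hd,
      Measure.prod_dirac, Measure.map_map hev.measurable (by fun_prop)]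
    rfl
  rw [ProbabilityMeasure.tendsto_iff_forall_integral_tendsto] at h4
  intro f
  have h5 := h4 f
  rw [key] at h5
  refine h5.congr fun n => ?_
  simp only [Function.comp]
  rw [key]

lemma coupling_bound {d : ℕ} {μ ρ : Measure (Euc d)} [IsProbabilityMeasure μ]
    [IsProbabilityMeasure ρ] {f : Euc d → ℝ} {B : ℝ} (hB : ∀ x y, dist (f x) (f y) ≤ B)
    {K : ℝ≥0} (hK : LipschitzWith K f) {c : ℝ} (hc : 0 ≤ c)
    (hW : W2sq μ ρ < ENNReal.ofReal c) {η : ℝ} (hη : 0 < η) :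
    |(∫ x, f x ∂μ) - ∫ x, f x ∂ρ| ≤ K * (η + c / η) := by
  unfold W2sq at hW
  simp only [iInf_lt_iff] at hW
  obtain ⟨π, ⟨h1, h2⟩, hπ⟩ := hW
  have : IsProbabilityMeasure π := by
    constructor
    have : π.map Prod.fst univ = 1 := by rw [h1]; simp
    rwa [Measure.map_apply measurable_fst MeasurableSet.univ] at this
  have hfb : ∃ D, ∀ x, ‖f x‖ ≤ D := ⟨‖f 0‖ + B, fun x => by
    have := hB x 0
    have h3 := norm_sub_norm_le (f x) (f 0)
    rw [dist_eq_norm] at this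
    linarith⟩
  obtain ⟨D, hD⟩ := hfb
  have hm : Measurable f := hK.continuous.measurable
  have i1 : Integrable (fun p : Euc d × Euc d => f p.1) π :=
    Integrable.of_bound (hm.comp measurable_fst).aestronglyMeasurable D (ae_of_all _ fun p => hD _)
  have i2 : Integrable (fun p : Euc d × Euc d => f p.2) π :=
    Integrable.of_bound (hm.comp measurable_snd).aestronglyMeasurable D (ae_of_all _ fun p => hD _)
  have e1 : ∫ x, f x ∂μ = ∫ p, f p.1 ∂π := by
    rw [← h1, integral_map measurable_fst.aemeasurable hm.aestronglyMeasurable]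
  have e2 : ∫ x, f x ∂ρ = ∫ p, f p.2 ∂π := by
    rw [← h2, integral_map measurable_snd.aemeasurable hm.aestronglyMeasurable]
  have md : Measurable (fun p : Euc d × Euc d => dist p.1 p.2 ^ 2) := by fun_prop
  have i3 : Integrable (fun p : Euc d × Euc d => dist p.1 p.2 ^ 2) π := by
    refine ⟨md.aestronglyMeasurable, ?_⟩
    rw [hasFiniteIntegral_iff_ofReal (ae_of_all _ fun p => by positivity)]
    exact hπ.trans ENNReal.ofReal_lt_top
  have hint : ∫ p : Euc d × Euc d, dist p.1 p.2 ^ 2 ∂π ≤ c := by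
    rw [integral_eq_lintegral_of_nonneg_ae (ae_of_all _ fun p => by positivity)
      md.aestronglyMeasurable]
    exact ENNReal.toReal_le_of_le_ofReal hc hπ.le
  rw [e1, e2, ← integral_sub i1 i2]
  calc |∫ p, (f p.1 - f p.2) ∂π| ≤ ∫ p, |f p.1 - f p.2| ∂π := abs_integral_le_integral_abs
    _ ≤ ∫ p : Euc d × Euc d, K * (η + dist p.1 p.2 ^ 2 / η) ∂π := by
      refine integral_mono (i1.sub i2).abs
        (((integrable_const _).add (i3.div_const η)).const_mul _) fun p => ?_
      have h4 := hK.dist_le_mul p.1 p.2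
      rw [Real.dist_eq] at h4
      refine h4.trans (mul_le_mul_of_nonneg_left ?_ K.2)
      have : 0 ≤ dist p.1 p.2 := dist_nonneg
      rw [← sub_nonneg]
      have : η + dist p.1 p.2 ^ 2 / η - dist p.1 p.2
        = (η^2 + dist p.1 p.2 ^ 2 - η * dist p.1 p.2) / η := by field_simp
      rw [this]
      apply div_nonneg _ hη.le
      nlinarith [sq_nonneg (η - dist p.1 p.2), sq_nonneg η, sq_nonneg (dist p.1 p.2)]
    _ = K * (η + (∫ p : Euc d × Euc d, dist p.1 p.2 ^ 2 ∂π) / η) := by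
      rw [integral_const_mul, integral_add (integrable_const _) (i3.div_const η),
        integral_div]
      simp
    _ ≤ _ := by gcongr

lemma moreau_liminf {d : ℕ} (Ω : Set (Euc d)) (F : Measure (Euc d) → ℝ≥0∞)
    (hFlsc : ∀ (ρ : ℕ → Measure (Euc d)) (σ : Measure (Euc d)),
      (∀ n, IsFiniteMeasure (ρ n)) → IsFiniteMeasure σ → NarrowTendsto ρ σ →
      F σ ≤ liminf (fun n => F (ρ n)) atTop)
    (ε : ℕ → ℝ) (hεpos : ∀ N, 0 < ε N) (hεlim : Tendsto ε atTop (𝓝 0))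
    {μ : ℕ → Measure (Euc d)} {ν : Measure (Euc d)} (hμ : ∀ n, IsProbabilityMeasure (μ n))
    (hν : IsProbabilityMeasure ν) (h : NarrowTendsto μ ν) :
    F ν ≤ liminf (fun n => moreau Ω F (ε n) (μ n)) atTop := by
  refine le_of_forall_gt_imp_ge_of_dense fun K hK => ?_
  by_cases hKt : K = ⊤
  · simp [hKt]
  obtain ⟨φ, hφ, hφK⟩ := extraction_of_frequently_atTop (frequently_lt_of_liminf_lt (by isBoundedDefault) hK)
  have hex : ∀ n, ∃ ρ : Measure (Euc d), IsProbabilityMeasure ρ ∧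
      W2sq (μ (φ n)) ρ < ENNReal.ofReal (K.toReal * (2 * ε (φ n))) ∧ F ρ ≤ K := by
    intro n
    have := hφK n
    unfold moreau at this
    simp only [iInf_lt_iff] at this
    obtain ⟨ρ, ⟨hρ, -⟩, hlt⟩ := this
    refine ⟨ρ, hρ, ?_, le_add_self.trans hlt.le⟩
    have h1 := lt_of_le_of_lt le_self_add hlt
    have h0 : 0 < 2 * ε (φ n) := by have := hεpos (φ n); positivity
    rw [ENNReal.div_lt_iff (Or.inl (by simpa using h0)) (Or.inl ENNReal.ofReal_ne_top)] at h1
    rwa [ENNReal.ofReal_mul ENNReal.toReal_nonneg, ENNReal.ofReal_toReal hKt]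
  choose ρ hρ hW hF using hex
  have hn : NarrowTendsto ρ ν := by
    rw [narrow_to_prob hρ hν, tendsto_iff_forall_lipschitz_integral_tendsto]
    rintro f ⟨B, hB⟩ ⟨Lf, hLf⟩
    simp only [coe_mkPM]
    rw [narrow_to_prob hμ hν, tendsto_iff_forall_lipschitz_integral_tendsto] at h
    have h1 : Tendsto (fun n => ∫ x, f x ∂(μ (φ n))) atTop (𝓝 (∫ x, f x ∂ν)) :=
      (h f ⟨B, hB⟩ ⟨Lf, hLf⟩).comp hφ.tendsto_atTop
    have h2 : Tendsto (fun n => (∫ x, f x ∂(μ (φ n))) - ∫ x, f x ∂(ρ n)) atTop (𝓝 0) := by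
      rw [Metric.tendsto_atTop']
      intro e he
      set η : ℝ := e / (2 * (Lf + 1)) with hηdef
      have hη : 0 < η := by positivity
      have h3 : Tendsto (fun n => (Lf : ℝ) * (η + (K.toReal * (2 * ε (φ n))) / η)) atTop
          (𝓝 (Lf * (η + (K.toReal * (2 * 0)) / η))) := by
        have := hεlim.comp hφ.tendsto_atTop
        exact (((this.const_mul 2).const_mul _).div_const _).const_add _ |>.const_mul _
      have h4 : (Lf : ℝ) * (η + (K.toReal * (2 * 0)) / η) < e := by
        simp only [mul_zero, zero_div, add_zero]
        rw [hηdef, mul_div_assoc', div_lt_iff₀ (by positivity)]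
        nlinarith [Lf.2]
      obtain ⟨N, hN⟩ := eventually_atTop.1 (h3.eventually_lt_const h4)
      refine ⟨N, fun n hn => ?_⟩
      rw [Real.dist_eq, sub_zero]
      have := hρ n
      have := hμ (φ n)
      have h0 := (hεpos (φ n)).le
      exact (coupling_bound hB hLf (by positivity) (hW n) hη).trans_lt (hN n hn.le)
    simpa using h1.sub h2
  refine (hFlsc ρ ν (fun n => inferInstance) inferInstance hn).trans ?_
  refine (liminf_le_liminf (v := fun _ => K) (Eventually.of_forall hF)).trans ?_
  simp

lemma lintegral_step (c : ℕ → ℝ≥0∞) {h : ℝ} (hh : 0 < h) (M : ℕ) :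
    ∫⁻ t in Set.Ico (0:ℝ) (M * h), c ⌊t / h⌋₊ = ENNReal.ofReal h * ∑ i ∈ Finset.range M, c i := by
  induction M with
  | zero => simp
  | succ M ih =>
    have hu : Set.Ico (0:ℝ) ((M + 1 : ℕ) * h) = Set.Ico 0 (M * h) ∪ Set.Ico (M * h) ((M + 1 : ℕ) * h) := by
      rw [Set.Ico_union_Ico_eq_Ico] <;> push_cast <;> first | positivity | nlinarith
    rw [hu, lintegral_union measurableSet_Ico (Set.Ico_disjoint_Ico_same), ih, Finset.sum_range_succ, mul_add]
    congr 1
    rw [setLIntegral_congr_fun (g := fun _ => c M) measurableSet_Ico]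
    · rw [setLIntegral_const, Real.volume_Ico, mul_comm]
      congr 2
      push_cast; ring
    · intro t ht
      have : ⌊t / h⌋₊ = M := by
        rw [Nat.floor_eq_iff (div_nonneg ((by positivity : (0:ℝ) ≤ M * h).trans ht.1) hh.le)]
        rw [le_div_iff₀ hh, div_lt_iff₀ hh]
        have := ht.2
        push_cast at this
        exact ⟨ht.1, this⟩
      simp [this]

lemma measurable_step (c : ℕ → ℝ≥0∞) (h : ℝ) : Measurable (fun t : ℝ => c ⌊t / h⌋₊) := by
  have : Measurable (fun t : ℝ => ⌊t / h⌋₊) := Nat.measurable_floor.comp (measurable_id.div_const h)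
  exact (measurable_from_top (f := c)).comp this

lemma tendsto_floor_mul {t : ℝ} (ht : 0 ≤ t) {h : ℕ → ℝ} (hpos : ∀ n, 0 < h n)
    (hlim : Tendsto h atTop (𝓝 0)) : Tendsto (fun n => (⌊t / h n⌋₊ : ℝ) * h n) atTop (𝓝 t) := by
  refine tendsto_of_tendsto_of_tendsto_of_le_of_le (g := fun n => t - h n) (h := fun _ => t)
    ?_ tendsto_const_nhds ?_ ?_
  · simpa using tendsto_const_nhds.sub hlim
  · intro n
    have := Nat.lt_floor_add_one (t / h n)
    rw [div_lt_iff₀ (hpos n)] at this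
    simp only
    linarith
  · intro n
    have := Nat.floor_le (div_nonneg ht (hpos n).le)
    rw [le_div_iff₀ (hpos n)] at this
    exact this

lemma F_part {d : ℕ} {T : ℝ} (hT : 0 < T) (Ω : Set (Euc d)) (F : Measure (Euc d) → ℝ≥0∞)
    (hFlsc : ∀ (ρ : ℕ → Measure (Euc d)) (σ : Measure (Euc d)),
      (∀ n, IsFiniteMeasure (ρ n)) → IsFiniteMeasure σ → NarrowTendsto ρ σ →
      F σ ≤ liminf (fun n => F (ρ n)) atTop)
    (δ : ℕ → ℝ) (M : ℕ → ℕ) (hδpos : ∀ N, 0 < δ N) (hMδ : ∀ N, (M N : ℝ) * δ N = T)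
    (hδlim : Tendsto δ atTop (𝓝 0))
    (ε : ℕ → ℝ) (hεpos : ∀ N, 0 < ε N) (hεlim : Tendsto ε atTop (𝓝 0))
    (Q : ℕ → Measure (Traj d T)) (hQ : ∀ N, IsProbabilityMeasure (Q N))
    (Qlim : Measure (Traj d T)) (hQlim : IsProbabilityMeasure Qlim)
    (hQcv : NarrowTendsto Q Qlim) :
    ∫⁻ t in Set.Ioc (0:ℝ) T, F (Qlim.map (evalAt hT.le t)) ≤
      liminf (fun N => ENNReal.ofReal (δ N) *
        ∑ i ∈ Finset.Ico 1 (M N),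
          moreau Ω F (ε N) ((Q N).map (evalAt hT.le (i * δ N)))) atTop := by
  set c : ℕ → ℕ → ℝ≥0∞ := fun N i => if i = 0 then 0 else
    moreau Ω F (ε N) ((Q N).map (evalAt hT.le (i * δ N))) with hc
  have hsum : ∀ N, ENNReal.ofReal (δ N) * ∑ i ∈ Finset.Ico 1 (M N),
      moreau Ω F (ε N) ((Q N).map (evalAt hT.le (i * δ N))) =
      ∫⁻ t in Set.Ioc (0:ℝ) T, c N ⌊t / δ N⌋₊ := by
    intro N
    rw [← restrict_Ico_eq_restrict_Ioc]
    have hst := lintegral_step (c N) (hδpos N) (M N)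
    rw [hMδ N] at hst
    rw [hst]
    congr 1
    rcases Nat.eq_zero_or_pos (M N) with h0 | h0
    · simp [h0]
    · rw [Finset.range_eq_Ico, Finset.sum_eq_sum_Ico_succ_bot h0]
      simp only [hc, if_true, zero_add]
      refine Finset.sum_congr rfl fun i hi => ?_
      rw [Finset.mem_Ico] at hi
      rw [if_neg (by omega)]
  simp_rw [hsum]
  refine le_trans ?_ (lintegral_liminf_le fun N => measurable_step _ _)
  refine setLIntegral_mono' measurableSet_Ioc fun t ht => ?_
  have hpr : ∀ (P : Measure (Traj d T)) [IsProbabilityMeasure P] (u : ℝ),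
      IsProbabilityMeasure (P.map (evalAt hT.le u)) := fun P _ u =>
    Measure.isProbabilityMeasure_map (measurable_evalAt _ _).measurable.aemeasurable
  have hn := narrow_evalAt hT.le hQ hQlim hQcv (tendsto_floor_mul ht.1.le hδpos hδlim)
  refine (moreau_liminf Ω F hFlsc ε hεpos hεlim (fun N => hpr _ _) (hpr _ _) hn).trans ?_
  refine liminf_le_liminf ?_
  filter_upwards [hδlim.eventually_lt_const ht.1] with N hN
  have : ⌊t / δ N⌋₊ ≠ 0 := by
    have : 1 ≤ ⌊t / δ N⌋₊ := by
      rw [Nat.one_le_floor_iff, le_div_iff₀ (hδpos N)]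
      linarith
    omega
  simp [hc, this]

end Helpers

section Kinetic

lemma jensen_interval {d : ℕ} {φ : Euc d → ℝ} (hφc : Continuous φ) (hφ0 : ∀ p, 0 ≤ φ p)
    (hφ : ConvexOn ℝ univ φ) {g : ℝ → Euc d} {a b : ℝ} (hab : a < b)
    (hg : IntegrableOn g (Ioc a b)) :
    ENNReal.ofReal ((b - a) * φ ((b - a)⁻¹ • ∫ u in a..b, g u)) ≤
      ∫⁻ t in Ioc a b, ENNReal.ofReal (φ (g t)) := by
  by_cases htop : ∫⁻ t in Ioc a b, ENNReal.ofReal (φ (g t)) = ⊤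
  · simp [htop]
  have hm : AEStronglyMeasurable (φ ∘ g) (volume.restrict (Ioc a b)) :=
    hφc.comp_aestronglyMeasurable hg.aestronglyMeasurable
  have hi : IntegrableOn (φ ∘ g) (Ioc a b) := by
    refine ⟨hm, ?_⟩
    change HasFiniteIntegral (fun t => φ (g t)) _
    rw [hasFiniteIntegral_iff_ofReal (ae_of_all _ fun p => hφ0 _)]
    exact lt_top_iff_ne_top.2 htop
  have hi' : Integrable (fun t => φ (g t)) (volume.restrict (Ioc a b)) := hi
  have hJ := hφ.map_set_average_le hφc.continuousOn isClosed_univ (μ := volume) (t := Ioc a b)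
    (by simp [hab]) (by simp) (by simp) hg hi
  rw [setAverage_eq, setAverage_eq] at hJ
  have hv : volume.real (Ioc a b) = b - a := by
    rw [Real.volume_real_Ioc_of_le hab.le]
  rw [hv, ← intervalIntegral.integral_of_le hab.le, smul_eq_mul] at hJ
  have hba : 0 < b - a := sub_pos.2 hab
  rw [← ofReal_integral_eq_lintegral_ofReal hi' (ae_of_all _ fun p => hφ0 _)]
  apply ENNReal.ofReal_le_ofReal
  calc _ ≤ (b - a) * ((b - a)⁻¹ * ∫ x in Ioc a b, φ (g x)) := by gcongr
    _ = _ := by rw [← mul_assoc, mul_inv_cancel₀ hba.ne', one_mul]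

/-- mesh size -/
noncomputable def msh (T : ℝ) (n : ℕ) : ℝ := T / (n + 1)

lemma msh_pos {T : ℝ} (hT : 0 < T) (n : ℕ) : 0 < msh T n := by unfold msh; positivity

lemma msh_mul (T : ℝ) (n : ℕ) : ((n + 1 : ℕ) : ℝ) * msh T n = T := by
  unfold msh; push_cast; field_simp

lemma msh_lim (T : ℝ) : Tendsto (msh T) atTop (𝓝 0) := by
  have := (tendsto_one_div_add_atTop_nhds_zero_nat (𝕜 := ℝ)).const_mul T
  simp only [mul_zero] at this
  refine this.congr fun n => ?_
  unfold msh; ring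

/-- difference quotient -/
noncomputable def dq {d : ℕ} (f : ℝ → Euc d) (h : ℝ) (k : ℕ) : Euc d :=
  h⁻¹ • (f ((k + 1 : ℕ) * h) - f (k * h))

/-- discrete action -/
noncomputable def Spart {d : ℕ} (T : ℝ) (φ : Euc d → ℝ) (n : ℕ) (f : ℝ → Euc d) : ℝ :=
  ∑ k ∈ Finset.range (n + 1), msh T n * φ (dq f (msh T n) k)

lemma grid_le {T : ℝ} (hT : 0 < T) {n k : ℕ} (hk : k ≤ n + 1) : (k : ℝ) * msh T n ≤ T := by
  conv_rhs => rw [← msh_mul T n]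
  have := msh_pos hT n
  gcongr

lemma Spart_le_action {d : ℕ} {T : ℝ} (hT : 0 < T) {L : Euc d → ℝ} {C : ℝ}
    (hφc : Continuous L) (hφ0 : ∀ p, 0 ≤ L p + C)
    (hφ : ConvexOn ℝ univ L) (n : ℕ) (γ : Traj d T) :
    ENNReal.ofReal (Spart T (fun p => L p + C) n (fun t => evalAt hT.le t γ)) ≤ actionN L C γ := by
  refine le_sInf ?_
  rintro _ ⟨g, hgi, hg, rfl⟩
  have hh := msh_pos hT n
  unfold Spart
  rw [ENNReal.ofReal_sum_of_nonneg fun k _ => mul_nonneg hh.le (hφ0 _)]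
  rw [intervalIntegrable_iff_integrableOn_Ioc_of_le hT.le] at hgi
  have hsub : ∀ k ∈ Finset.range (n+1),
      Ioc ((k:ℝ) * msh T n) ((k + 1 : ℕ) * msh T n) ⊆ Ioc 0 T := by
    intro k hk
    rw [Finset.mem_range] at hk
    exact Ioc_subset_Ioc (by positivity) (grid_le hT (by omega))
  have hterm : ∀ k ∈ Finset.range (n+1),
      ENNReal.ofReal (msh T n * (L (dq (fun t => evalAt hT.le t γ) (msh T n) k) + C)) ≤
      ∫⁻ t in Ioc ((k:ℝ) * msh T n) ((k + 1 : ℕ) * msh T n), ENNReal.ofReal (L (g t) + C) := by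
    intro k hk
    have hk' := Finset.mem_range.1 hk
    have hlt : (k:ℝ) * msh T n < (k + 1 : ℕ) * msh T n := by push_cast; nlinarith
    have h0 : (0:ℝ) ≤ (k:ℝ) * msh T n := by positivity
    have hT' : ((k + 1 : ℕ):ℝ) * msh T n ≤ T := grid_le hT (by omega)
    have hJ := jensen_interval (φ := fun p => L p + C) (by fun_prop) hφ0
      (hφ.add (convexOn_const C convex_univ)) hlt (hgi.mono_set (hsub k hk))
    convert hJ using 2
    have e1 : ((k + 1 : ℕ):ℝ) * msh T n - (k:ℝ) * msh T n = msh T n := by push_cast; ring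
    rw [e1]
    have e2 := hg ⟨(k:ℝ) * msh T n, h0, by linarith⟩ ⟨((k + 1 : ℕ):ℝ) * msh T n, by linarith, hT'⟩
    rw [← e2]
    have p1 := projIcc_of_mem hT.le (x := (k:ℝ) * msh T n) ⟨h0, by linarith⟩
    have p2 := projIcc_of_mem hT.le (x := ((k + 1 : ℕ):ℝ) * msh T n) ⟨by linarith, hT'⟩
    simp only [dq, evalAt, p1, p2]
  refine (Finset.sum_le_sum hterm).trans ?_
  rw [← lintegral_biUnion_finset]
  · exact lintegral_mono_set (iUnion₂_subset hsub)
  · have hmono : Monotone (fun k : ℕ => (k:ℝ) * msh T n) := fun i j hij => by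
      simp only; gcongr
    have := hmono.pairwise_disjoint_on_Ioc_succ
    intro i _ j _ hij
    exact this hij
  · exact fun _ _ => measurableSet_Ioc

lemma young_aux {s l r : ℝ} (hs : 0 ≤ s) (hl : 0 < l) (hr : 1 < r) :
    s ≤ l + l ^ (1 - r) * s ^ r := by
  rcases le_or_gt s l with h | h
  · have : 0 ≤ l ^ (1 - r) * s ^ r := by positivity
    linarith
  · have hs' : 0 < s := hl.trans h
    have h1 : s = s ^ (1 - r) * s ^ r := by
      rw [← Real.rpow_add hs']; simp
    have h2 : s ^ (1 - r) ≤ l ^ (1 - r) :=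
      Real.rpow_le_rpow_of_nonpos hl h.le (by linarith)
    have h3 : s ^ (1 - r) * s ^ r ≤ l ^ (1 - r) * s ^ r := by gcongr
    linarith

open Classical in
lemma pair_bound {d : ℕ} {T : ℝ} (hT : 0 < T) (f : ℝ → Euc d) (n : ℕ) {r l : ℝ} (hr : 1 < r)
    (hl : 0 < l) {x y : ℝ} (hx : x ∈ Icc 0 T) (hy : y ∈ Icc 0 T) (hxy : x ≤ y) :
    dist (f (⌊x / msh T n⌋₊ * msh T n)) (f (⌊y / msh T n⌋₊ * msh T n)) ≤
      l * dist ((⌊x / msh T n⌋₊ : ℝ) * msh T n) (⌊y / msh T n⌋₊ * msh T n) +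
      ∑ k ∈ Finset.range (n + 1), (if ((k + 1 : ℕ) : ℝ) * msh T n ∈ Ioc x y then
        l ^ (1 - r) * (msh T n * ‖dq f (msh T n) k‖ ^ r) else 0) := by
  set h := msh T n with hh
  have hp : 0 < h := msh_pos hT n
  set a := ⌊x / h⌋₊
  set b := ⌊y / h⌋₊ with hb
  have hab : a ≤ b := Nat.floor_mono (by gcongr)
  have hbn : b ≤ n + 1 := by
    have : y / h ≤ (n + 1 : ℕ) := by
      rw [div_le_iff₀ hp, msh_mul]; exact hy.2
    exact Nat.floor_le_of_le this
  have h1 := dist_le_Ico_sum_dist (fun k : ℕ => f (k * h)) hab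
  refine h1.trans ?_
  have h2 : ∀ k ∈ Finset.Ico a b, dist (f ((k:ℝ) * h)) (f ((k + 1 : ℕ) * h)) ≤
      l * h + l ^ (1 - r) * (h * ‖dq f h k‖ ^ r) := by
    intro k _
    have e : dist (f ((k:ℝ) * h)) (f ((k + 1 : ℕ) * h)) = h * ‖dq f h k‖ := by
      unfold dq
      rw [norm_smul, norm_inv, Real.norm_of_nonneg hp.le, ← mul_assoc, mul_inv_cancel₀ hp.ne',
        one_mul, dist_comm, dist_eq_norm]
    rw [e]
    have := young_aux (norm_nonneg (dq f h k)) hl hr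
    nlinarith
  refine (Finset.sum_le_sum h2).trans ?_
  rw [Finset.sum_add_distrib]
  refine add_le_add (le_of_eq ?_) ?_
  · rw [Finset.sum_const, Nat.card_Ico, nsmul_eq_mul, Nat.cast_sub hab, dist_comm, Real.dist_eq,
      ← sub_mul, abs_of_nonneg]
    · ring
    · have : (a:ℝ) ≤ b := by exact_mod_cast hab
      exact mul_nonneg (by linarith) hp.le
  · rw [← Finset.sum_filter]
    refine Finset.sum_le_sum_of_subset_of_nonneg ?_ fun _ _ _ => by positivity
    intro k hk
    rw [Finset.mem_Ico] at hk
    rw [Finset.mem_filter, Finset.mem_range]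
    refine ⟨by omega, ?_, ?_⟩
    · have : x / h < a + 1 := Nat.lt_floor_add_one _
      rw [div_lt_iff₀ hp] at this
      refine this.trans_le ?_
      have : (a:ℝ) ≤ k := by exact_mod_cast hk.1
      push_cast
      gcongr
    · have : (b:ℝ) ≤ y / h := Nat.floor_le (div_nonneg hy.1 hp.le)
      rw [le_div_iff₀ hp] at this
      refine le_trans ?_ this
      have : ((k + 1 : ℕ):ℝ) ≤ b := by exact_mod_cast hk.2
      gcongr

open Classical in
lemma pair_bound' {d : ℕ} {T : ℝ} (hT : 0 < T) (f : ℝ → Euc d) (n : ℕ) {r l : ℝ} (hr : 1 < r)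
    (hl : 0 < l) {x y : ℝ} (hx : x ∈ Icc 0 T) (hy : y ∈ Icc 0 T) :
    dist (f (⌊x / msh T n⌋₊ * msh T n)) (f (⌊y / msh T n⌋₊ * msh T n)) ≤
      l * dist ((⌊x / msh T n⌋₊ : ℝ) * msh T n) (⌊y / msh T n⌋₊ * msh T n) +
      ∑ k ∈ Finset.range (n + 1), (if ((k + 1 : ℕ) : ℝ) * msh T n ∈ uIoc x y then
        l ^ (1 - r) * (msh T n * ‖dq f (msh T n) k‖ ^ r) else 0) := by
  rcases le_total x y with h | h
  · rw [uIoc_of_le h]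
    convert pair_bound hT f n hr hl hx hy h
  · rw [uIoc_of_ge h, dist_comm, dist_comm ((⌊x / msh T n⌋₊ : ℝ) * msh T n)]
    convert pair_bound hT f n hr hl hy hx h

open Classical in
lemma ac_of_bound {d : ℕ} {T : ℝ} (hT : 0 < T) {f : ℝ → Euc d} (hf : Continuous f) {r K : ℝ}
    (hr : 1 < r) (hK : 0 ≤ K)
    (hb : ∃ᶠ n in atTop, ∑ k ∈ Finset.range (n + 1),
      msh T n * ‖dq f (msh T n) k‖ ^ r ≤ K) :
    AbsolutelyContinuousOnInterval f 0 T := by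
  rw [absolutelyContinuousOnInterval_iff]
  intro e he
  obtain ⟨l, hl, hlK⟩ : ∃ l : ℝ, 0 < l ∧ l ^ (1 - r) * K < e / 2 := by
    have h1 := (tendsto_rpow_neg_atTop (y := r - 1) (by linarith)).mul_const K
    rw [zero_mul] at h1
    have h2 := (h1.eventually_lt_const (half_pos he)).and (eventually_gt_atTop (0:ℝ))
    obtain ⟨l, h3, h4⟩ := h2.exists
    refine ⟨l, h4, ?_⟩
    rwa [neg_sub] at h3
  refine ⟨e / (2 * l), by positivity, fun E hE hlen => ?_⟩
  obtain ⟨hmem, hdisj⟩ := hE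
  rw [uIcc_of_le hT.le] at hmem
  set p : ℕ → ℝ → ℝ := fun n x => ⌊x / msh T n⌋₊ * msh T n with hp
  have hplim : ∀ x, 0 ≤ x → Tendsto (fun n => p n x) atTop (𝓝 x) := fun x hx =>
    tendsto_floor_mul hx (msh_pos hT) (msh_lim T)
  have hlim : Tendsto (fun n => (∑ i ∈ Finset.range E.1,
        dist (f (p n (E.2 i).1)) (f (p n (E.2 i).2)))
        - l * ∑ i ∈ Finset.range E.1, dist (p n (E.2 i).1) (p n (E.2 i).2)) atTop
      (𝓝 ((∑ i ∈ Finset.range E.1, dist (f (E.2 i).1) (f (E.2 i).2))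
        - l * ∑ i ∈ Finset.range E.1, dist (E.2 i).1 (E.2 i).2)) := by
    refine Tendsto.sub (tendsto_finsetSum _ fun i hi => ?_)
      (Tendsto.const_mul _ (tendsto_finsetSum _ fun i hi => ?_))
    · exact ((hf.tendsto _).comp (hplim _ (hmem i hi).1.1)).dist
        ((hf.tendsto _).comp (hplim _ (hmem i hi).2.1))
    · exact (hplim _ (hmem i hi).1.1).dist (hplim _ (hmem i hi).2.1)
  have hfin := le_of_tendsto_of_frequently (b := l ^ (1 - r) * K) hlim (hb.mono fun n hn => ?_)
  · have h1 : l * ∑ i ∈ Finset.range E.1, dist (E.2 i).1 (E.2 i).2 < e / 2 := by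
      calc _ < l * (e / (2 * l)) := by gcongr
        _ = e / 2 := by field_simp
    linarith
  · have h1 := Finset.sum_le_sum fun i hi =>
      pair_bound' hT f n hr hl (hmem i hi).1 (hmem i hi).2
    rw [Finset.sum_add_distrib, ← Finset.mul_sum, Finset.sum_comm] at h1
    have h2 : ∀ k ∈ Finset.range (n + 1), (∑ i ∈ Finset.range E.1,
        if ((k + 1 : ℕ) : ℝ) * msh T n ∈ uIoc (E.2 i).1 (E.2 i).2 then
        l ^ (1 - r) * (msh T n * ‖dq f (msh T n) k‖ ^ r) else 0) ≤
        l ^ (1 - r) * (msh T n * ‖dq f (msh T n) k‖ ^ r) := by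
      intro k _
      rw [← Finset.sum_filter, Finset.sum_const, nsmul_eq_mul]
      have hc : (Finset.filter (fun i => ((k + 1 : ℕ) : ℝ) * msh T n ∈
          uIoc (E.2 i).1 (E.2 i).2) (Finset.range E.1)).card ≤ 1 := by
        rw [Finset.card_le_one]
        intro i hi j hj
        rw [Finset.mem_filter] at hi hj
        by_contra hij
        exact Set.disjoint_left.1 (hdisj (by exact_mod_cast hi.1) (by exact_mod_cast hj.1) hij)
          hi.2 hj.2
      have hc' : ((Finset.filter (fun i => ((k + 1 : ℕ) : ℝ) * msh T n ∈
          uIoc (E.2 i).1 (E.2 i).2) (Finset.range E.1)).card : ℝ) ≤ 1 := by exact_mod_cast hc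
      have := (msh_pos hT n).le
      exact mul_le_of_le_one_left (by positivity) hc'
    have h3 := Finset.sum_le_sum h2
    rw [← Finset.mul_sum] at h3
    have h4 : l ^ (1 - r) * ∑ k ∈ Finset.range (n + 1), msh T n * ‖dq f (msh T n) k‖ ^ r
      ≤ l ^ (1 - r) * K := by gcongr
    simp only [hp]
    linarith

lemma exists_density {d : ℕ} {T : ℝ} (hT : 0 < T) {f : ℝ → Euc d}
    (hf : AbsolutelyContinuousOnInterval f 0 T) :
    ∃ g : ℝ → Euc d, IntervalIntegrable g volume 0 T ∧
      ∀ s ∈ Icc 0 T, ∀ t ∈ Icc 0 T, f t - f s = ∫ u in s..t, g u := by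
  have hj : ∀ j, AbsolutelyContinuousOnInterval (fun t => f t j) 0 T := by
    intro j
    rw [absolutelyContinuousOnInterval_iff] at hf ⊢
    intro e he
    obtain ⟨δ, hδ, h⟩ := hf e he
    refine ⟨δ, hδ, fun E hE hl => lt_of_le_of_lt (Finset.sum_le_sum fun i _ => ?_) (h E hE hl)⟩
    rw [dist_eq_norm, dist_eq_norm]
    exact PiLp.norm_apply_le (f (E.2 i).1 - f (E.2 i).2) j
  have hgi : ∀ s ∈ Icc 0 T, ∀ t ∈ Icc 0 T, ∀ j,
      IntervalIntegrable (deriv (fun t => f t j)) volume s t := fun s hs t ht j =>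
    ((hj j).mono (by rw [uIcc_of_le hT.le]; exact uIcc_subset_Icc hs ht)).intervalIntegrable_deriv
  set g : ℝ → Euc d := fun t => WithLp.toLp 2 (fun j => deriv (fun t => f t j) t) with hg
  have h0 : (0:ℝ) ∈ Icc 0 T := ⟨le_rfl, hT.le⟩
  have hTT : T ∈ Icc 0 T := ⟨hT.le, le_rfl⟩
  have hi : ∀ s ∈ Icc 0 T, ∀ t ∈ Icc 0 T, IntervalIntegrable g volume s t := by
    intro s hs t ht
    rw [intervalIntegrable_iff]
    refine Integrable.of_eval_piLp fun j => ?_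
    have := hgi s hs t ht j
    rw [intervalIntegrable_iff] at this
    exact this
  refine ⟨g, hi 0 h0 T hTT, fun s hs t ht => ?_⟩
  ext j
  have e1 : (∫ u in s..t, g u) j = ∫ u in s..t, g u j :=
    ((EuclideanSpace.proj (𝕜 := ℝ) j).intervalIntegral_comp_comm (hi s hs t ht)).symm
  rw [e1]
  have hAC : AbsolutelyContinuousOnInterval (fun t => f t j) s t :=
    (hj j).mono (by rw [uIcc_of_le hT.le]; exact uIcc_subset_Icc hs ht)
  have := hAC.integral_deriv_eq_sub
  simp only [hg]
  rw [this]
  rfl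

lemma straddle {d : ℕ} {f : ℝ → Euc d} {v : Euc d} {t : ℝ} (ht : 0 ≤ t) (hf : HasDerivAt f v t)
    {h : ℕ → ℝ} (hpos : ∀ n, 0 < h n) (hlim : Tendsto h atTop (𝓝 0)) :
    Tendsto (fun n => dq f (h n) ⌊t / h n⌋₊) atTop (𝓝 v) := by
  rw [Metric.tendsto_atTop']
  intro e he
  have h1 := (hasDerivAt_iff_isLittleO.1 hf).def (half_pos he)
  obtain ⟨η, hη, hball⟩ := Metric.eventually_nhds_iff.1 h1
  obtain ⟨N, hN⟩ := eventually_atTop.1 (hlim.eventually_lt_const hη)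
  refine ⟨N, fun n hn => ?_⟩
  have hh := hpos n
  have hhη := hN n hn.le
  set a := (⌊t / h n⌋₊ : ℝ) * h n with ha
  have ha1 : a ≤ t := by
    have := Nat.floor_le (div_nonneg ht hh.le)
    rwa [le_div_iff₀ hh] at this
  have hb : ((⌊t / h n⌋₊ + 1 : ℕ) : ℝ) * h n = a + h n := by push_cast; ring
  have hb1 : t < a + h n := by
    have := Nat.lt_floor_add_one (t / h n)
    rw [div_lt_iff₀ hh] at this
    linarith
  have i1 := hball (y := a) (by rw [Real.dist_eq, abs_lt]; constructor <;> linarith)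
  have i2 := hball (y := a + h n) (by rw [Real.dist_eq, abs_lt]; constructor <;> linarith)
  rw [Real.norm_eq_abs, abs_of_nonpos (by linarith)] at i1
  rw [Real.norm_eq_abs, abs_of_nonneg (by linarith)] at i2
  have e1 : dq f (h n) ⌊t / h n⌋₊ - v = (h n)⁻¹ • ((f (a + h n) - f t - (a + h n - t) • v)
      - (f a - f t - (a - t) • v)) := by
    unfold dq
    rw [hb, ← ha]
    have : v = (h n)⁻¹ • (h n • v) := by rw [smul_smul, inv_mul_cancel₀ hh.ne', one_smul]
    nth_rewrite 1 [this]
    rw [← smul_sub]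
    congr 1
    module
  rw [dist_eq_norm, e1, norm_smul, norm_inv, Real.norm_of_nonneg hh.le, inv_mul_lt_iff₀ hh]
  refine (norm_sub_le _ _).trans_lt ?_
  nlinarith

lemma action_le_liminf {d : ℕ} {T : ℝ} (hT : 0 < T) {L : Euc d → ℝ} {r C : ℝ} (hr : 1 < r)
    (hC : 0 < C) (hLc : Continuous L)
    (hlow : ∀ p : Euc d, 1 / (r * C) * ‖p‖ ^ r - C ≤ L p) (γ : Traj d T) :
    actionN L C γ ≤ liminf (fun n => ENNReal.ofReal
      (Spart T (fun p => L p + C) n (fun t => evalAt hT.le t γ))) atTop := by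
  by_cases htop : liminf (fun n => ENNReal.ofReal
      (Spart T (fun p => L p + C) n (fun t => evalAt hT.le t γ))) atTop = ⊤
  · simp [htop]
  set f : ℝ → Euc d := fun t => evalAt hT.le t γ with hf
  have hfc : Continuous f := by
    simp only [hf]; unfold evalAt
    exact γ.continuous.comp continuous_projIcc
  have hrC : 0 < r * C := by positivity
  have hφ0 : ∀ p : Euc d, 0 ≤ L p + C := fun p => by
    have := hlow p
    have h2 : 0 ≤ 1 / (r * C) * ‖p‖ ^ r := by positivity
    linarith
  obtain ⟨K, hK, hKt⟩ := exists_between (lt_top_iff_ne_top.2 htop)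
  have hfr := frequently_lt_of_liminf_lt (by isBoundedDefault) hK
  have hAC : AbsolutelyContinuousOnInterval f 0 T := by
    refine ac_of_bound hT hfc (K := r * C * K.toReal) hr (by positivity) (hfr.mono fun n hn => ?_)
    have h1 : Spart T (fun p => L p + C) n f ≤ K.toReal :=
      (ENNReal.ofReal_le_iff_le_toReal hKt.ne).1 hn.le
    refine le_trans ?_ (mul_le_mul_of_nonneg_left h1 hrC.le)
    unfold Spart
    rw [Finset.mul_sum]
    refine Finset.sum_le_sum fun k _ => ?_
    have h2 := hlow (dq f (msh T n) k)
    have h3 : ‖dq f (msh T n) k‖ ^ r ≤ r * C * (L (dq f (msh T n) k) + C) := by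
      have : 1 / (r * C) * ‖dq f (msh T n) k‖ ^ r ≤ L (dq f (msh T n) k) + C := by linarith
      rw [one_div, inv_mul_le_iff₀ hrC] at this
      exact this
    have := msh_pos hT n
    calc _ ≤ msh T n * (r * C * (L (dq f (msh T n) k) + C)) := by gcongr
      _ = _ := by ring
  obtain ⟨g, hgi, hg⟩ := exists_density hT hAC
  have hstep : ∀ n, ENNReal.ofReal (Spart T (fun p => L p + C) n f) =
      ∫⁻ t in Ioc 0 T, ENNReal.ofReal (L (dq f (msh T n) ⌊t / msh T n⌋₊) + C) := by
    intro n
    have h1 := lintegral_step (fun k => ENNReal.ofReal (L (dq f (msh T n) k) + C)) (msh_pos hT n)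
      (n + 1)
    rw [msh_mul] at h1
    rw [← restrict_Ico_eq_restrict_Ioc, h1]
    unfold Spart
    rw [← Finset.mul_sum, ENNReal.ofReal_mul (msh_pos hT n).le,
      ENNReal.ofReal_sum_of_nonneg fun k _ => hφ0 _]
  have hder : ∀ᵐ t, t ∈ Ioc 0 T → HasDerivAt f (g t) t := by
    have hne : ∀ᵐ t : ℝ, t ≠ T := by simp [ae_iff, measure_singleton]
    filter_upwards [hgi.ae_hasDerivAt_integral, hne] with t h1 h2 ht
    have hlt : t < T := lt_of_le_of_ne ht.2 h2
    rw [uIcc_of_le hT.le] at h1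
    have h3 := (h1 ⟨ht.1.le, ht.2⟩ 0 ⟨le_rfl, hT.le⟩).const_add (f 0)
    refine h3.congr_of_eventuallyEq ?_
    filter_upwards [Ioo_mem_nhds ht.1 hlt] with u hu
    rw [← hg 0 ⟨le_rfl, hT.le⟩ u ⟨hu.1.le, hu.2.le⟩]
    abel
  calc actionN L C γ ≤ ∫⁻ t in Ioc 0 T, ENNReal.ofReal (L (g t) + C) := by
        refine sInf_le ⟨g, hgi, fun s t => ?_, rfl⟩
        have := hg s s.2 t t.2
        simpa [hf, evalAt] using this
    _ ≤ ∫⁻ t in Ioc 0 T, liminf (fun n =>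
          ENNReal.ofReal (L (dq f (msh T n) ⌊t / msh T n⌋₊) + C)) atTop := by
        refine lintegral_mono_ae ?_
        rw [ae_restrict_iff' measurableSet_Ioc]
        filter_upwards [hder] with t h1 ht
        have h2 := straddle ht.1.le (h1 ht) (msh_pos hT) (msh_lim T)
        have h3 : Continuous (fun p => ENNReal.ofReal (L p + C)) :=
          ENNReal.continuous_ofReal.comp (hLc.add continuous_const)
        exact ((h3.tendsto _).comp h2).liminf_eq.ge
    _ ≤ liminf (fun n => ∫⁻ t in Ioc 0 T,
          ENNReal.ofReal (L (dq f (msh T n) ⌊t / msh T n⌋₊) + C)) atTop :=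
        lintegral_liminf_le fun n =>
          measurable_step (fun k => ENNReal.ofReal (L (dq f (msh T n) k) + C)) _
    _ = _ := by simp_rw [hstep]

lemma kin_part {d : ℕ} {T : ℝ} (hT : 0 < T) {L : Euc d → ℝ} {r C : ℝ} (hr : 1 < r)
    (hC : 0 < C) (hLc : Continuous L) (hLconv : ConvexOn ℝ univ L)
    (hlow : ∀ p : Euc d, 1 / (r * C) * ‖p‖ ^ r - C ≤ L p)
    (Q : ℕ → Measure (Traj d T)) (hQ : ∀ N, IsProbabilityMeasure (Q N))
    (Qlim : Measure (Traj d T)) (hQlim : IsProbabilityMeasure Qlim)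
    (hQcv : NarrowTendsto Q Qlim) :
    ∫⁻ γ, actionN L C γ ∂Qlim ≤ liminf (fun N => ∫⁻ γ, actionN L C γ ∂(Q N)) atTop := by
  have hφ0 : ∀ p : Euc d, 0 ≤ L p + C := fun p => by
    have := hlow p
    have h2 : 0 ≤ 1 / (r * C) * ‖p‖ ^ r := by positivity
    linarith
  have hSc : ∀ n, Continuous (fun γ : Traj d T =>
      Spart T (fun p => L p + C) n (fun t => evalAt hT.le t γ)) := by
    intro n
    unfold Spart dq
    refine continuous_finsetSum _ fun k _ => ?_
    have h1 := measurable_evalAt (d := d) hT.le (((k + 1 : ℕ) : ℝ) * msh T n)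
    have h2 := measurable_evalAt (d := d) hT.le ((k : ℝ) * msh T n)
    have h3 : Continuous fun γ : Traj d T => (msh T n)⁻¹ •
        (evalAt hT.le (((k + 1 : ℕ) : ℝ) * msh T n) γ - evalAt hT.le ((k : ℝ) * msh T n) γ) :=
      Continuous.const_smul (Continuous.sub h1 h2) (msh T n)⁻¹
    exact continuous_const.mul ((hLc.comp h3).add continuous_const)
  have hS0 : ∀ n, 0 ≤ (fun γ : Traj d T =>
      Spart T (fun p => L p + C) n (fun t => evalAt hT.le t γ)) := fun n γ =>
    Finset.sum_nonneg fun k _ => mul_nonneg (msh_pos hT n).le (hφ0 _)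
  rw [narrow_to_prob hQ hQlim] at hQcv
  calc _ ≤ ∫⁻ γ, liminf (fun n => ENNReal.ofReal
      (Spart T (fun p => L p + C) n (fun t => evalAt hT.le t γ))) atTop ∂Qlim :=
        lintegral_mono fun γ => action_le_liminf hT hr hC hLc hlow γ
    _ ≤ liminf (fun n => ∫⁻ γ, ENNReal.ofReal
      (Spart T (fun p => L p + C) n (fun t => evalAt hT.le t γ)) ∂Qlim) atTop :=
        lintegral_liminf_le fun n => (hSc n).measurable.ennreal_ofReal
    _ ≤ _ := by
      refine (liminf_le_liminf (v := fun _ => liminf (fun N => ∫⁻ γ, actionN L C γ ∂(Q N)) atTop)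
        (Eventually.of_forall fun n => ?_)).trans (by simp)
      refine (lintegral_le_liminf_lintegral_of_forall_isOpen_measure_le_liminf_measure
        (μs := Q) (hSc n) (hS0 n) fun G hG =>
          ProbabilityMeasure.le_liminf_measure_open_of_tendsto hQcv hG).trans ?_
      refine liminf_le_liminf (Eventually.of_forall fun N => lintegral_mono fun γ => ?_)
      exact Spart_le_action hT hLc hφ0 hLconv n γ

end Kinetic

/-- **Fully discrete, lower bound.** If `δ_N → 0`, `ε_N → 0`, `μ⁰_N → μ⁰`
narrowly, and `Q_N → Q_∞` narrowly in `P(Γ)`, then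
`J(Q_∞) ≤ liminf_N J_{δ_N, ε_N}(Q_N)`. -/
theorem fully_discrete_lower_bound
    (d : ℕ) (T : ℝ) (hT : 0 < T)
    (Ω : Set (Euc d)) (hΩc : IsCompact Ω) (hΩmeas : MeasurableSet Ω) (hΩne : Ω.Nonempty)
    (r C : ℝ) (hr : 1 < r) (hC : 0 < C)
    (L : Euc d → ℝ) (hLconv : ConvexOn ℝ Set.univ L) (hLcont : Continuous L)
    (hLgrow : ∀ p : Euc d, 1 / (r * C) * ‖p‖ ^ r - C ≤ L p ∧ L p ≤ C / r * ‖p‖ ^ r + C)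
    (F : Measure (Euc d) → ℝ≥0∞)
    (hFlsc : ∀ (ρ : ℕ → Measure (Euc d)) (σ : Measure (Euc d)),
      (∀ n, IsFiniteMeasure (ρ n)) → IsFiniteMeasure σ → NarrowTendsto ρ σ →
      F σ ≤ liminf (fun n => F (ρ n)) atTop)
    (hFsupp : ∀ ρ : Measure (Euc d), F ρ ≠ ⊤ → ρ Ωᶜ = 0)
    (G : Measure (Traj d T) → ℝ)
    (hGcont : ∀ (Q : ℕ → Measure (Traj d T)) (Q' : Measure (Traj d T)),
      (∀ n, IsProbabilityMeasure (Q n)) → IsProbabilityMeasure Q' →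
      NarrowTendsto Q Q' → Tendsto (fun n => G (Q n)) atTop (𝓝 (G Q')))
    (hGbdd : BddBelow (Set.range G))
    -- uniform time grids `0, δ_N, …, M_N δ_N = T`
    (δ : ℕ → ℝ) (M : ℕ → ℕ) (hδpos : ∀ N, 0 < δ N) (hMδ : ∀ N, (M N : ℝ) * δ N = T)
    (hδlim : Tendsto δ atTop (𝓝 0))
    (ε : ℕ → ℝ) (hεpos : ∀ N, 0 < ε N) (hεlim : Tendsto ε atTop (𝓝 0))
    (μ0 : Measure (Euc d)) (hμ0 : IsProbabilityMeasure μ0)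
    (μ0N : ℕ → Measure (Euc d)) (hμ0N : ∀ N, IsProbabilityMeasure (μ0N N))
    (hμ0Ncv : NarrowTendsto μ0N μ0)
    (Q : ℕ → Measure (Traj d T)) (hQ : ∀ N, IsProbabilityMeasure (Q N))
    (Qlim : Measure (Traj d T)) (hQlim : IsProbabilityMeasure Qlim)
    (hQcv : NarrowTendsto Q Qlim) :
    Jfun hT.le L C F G Qlim
      ≤ liminf (fun N => Jde hT.le Ω L C F G (δ N) (ε N) (M N) (Q N)) atTop := by
  have h1 := kin_part hT hr hC hLcont hLconv (fun p => (hLgrow p).1) Q hQ Qlim hQlim hQcv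
  have h2 := F_part hT Ω F hFlsc δ M hδpos hMδ hδlim ε hεpos hεlim Q hQ Qlim hQlim hQcv
  have h3 := (continuous_coe_real_ereal.tendsto _).comp (hGcont Q Qlim hQ hQlim hQcv)
  have hco : ∀ u : ℕ → ℝ≥0∞, ((liminf u atTop : ℝ≥0∞) : EReal)
      = liminf (fun N => ((u N : ℝ≥0∞) : EReal)) atTop := fun u =>
    EReal.coe_ennreal_strictMono.monotone.map_liminf_of_continuousAt u
      continuous_coe_ennreal_ereal.continuousAt
  have h1' := EReal.coe_ennreal_le_coe_ennreal_iff.2 h1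
  have h2' := EReal.coe_ennreal_le_coe_ennreal_iff.2 h2
  rw [hco] at h1' h2'
  unfold Jfun Jde kinE
  simp only [sub_eq_add_neg]
  refine le_trans (add_le_add (add_le_add (add_le_add h1'
    (liminf_const (f := (atTop : Filter ℕ)) (-((C * T : ℝ) : EReal))).ge) h2') h3.liminf_eq.ge) ?_
  refine le_trans ?_ EReal.le_liminf_add
  refine add_le_add (le_trans ?_ EReal.le_liminf_add) le_rfl
  exact add_le_add EReal.le_liminf_add le_rfl
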